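/- Fix a natural number N and let Q_N ∈ ℂ[X] be the polynomial whose value at u is Σ_{k=0}^{N} 2^k · (−N)_k · (i·u + 1/2)_k / (k!)². Then neither i/2 nor −i/2 is a root of Q_N, and the sum over the roots u of Q_N in ℂ (counted with multiplicity) of 2/(u² + 1/4) equals 4·(S₁(N) − S_{−1}(N)). -/

import Mathlib

/-- Nested (signed) harmonic sum `S_{a₁,…,a_ℓ}(N)`,
`S_{a₁,…,a_ℓ}(N) = Σ_{n=1}^{N} (sign a₁)^n / n^{|a₁|} · S_{a₂,…,a_ℓ}(n)`, with `S_{}(n) = 1`. -/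
noncomputable def nestedS : List ℤ → ℕ → ℝ
  | [], _ => 1
  | a :: b, N => ∑ n ∈ Finset.Icc 1 N, ((Int.sign a : ℝ)) ^ n / (n : ℝ) ^ a.natAbs * nestedS b n

/-- Twist-1 Baxter polynomial as an element of `ℂ[X]`:
its value at `u` is `Σ_{k=0}^{N} 2^k (−N)_k (i·u+1/2)_k / (k!)²`. -/
noncomputable def baxterQ1Poly (N : ℕ) : Polynomial ℂ :=
  ∑ k ∈ Finset.range (N + 1),
    Polynomial.C (2 ^ k * (ascPochhammer ℂ k).eval (-(N : ℂ)) / ((k.factorial : ℂ)) ^ 2) *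
      (ascPochhammer ℂ k).comp (Polynomial.C Complex.I * Polynomial.X + Polynomial.C (1 / 2))

/-- The alternating binomial transform `Σ_{k ≤ N} C(N,k) (-2)^k f k`. -/
noncomputable def binomialTransform (N : ℕ) (f : ℕ → ℂ) : ℂ :=
  ∑ k ∈ Finset.range (N + 1), (N.choose k : ℂ) * (-2) ^ k * f k

lemma binomialTransform_add (N : ℕ) (f g : ℕ → ℂ) :
    binomialTransform N (fun k => f k + g k) = binomialTransform N f + binomialTransform N g := by
  simp only [binomialTransform, mul_add, Finset.sum_add_distrib]

lemma binomialTransform_succ (N : ℕ) (f : ℕ → ℂ) :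
    binomialTransform (N + 1) f =
      binomialTransform N f - 2 * binomialTransform N (fun k => f (k + 1)) := by
  have h : binomialTransform N f =
      f 0 + ∑ k ∈ Finset.range (N + 1), (N.choose (k + 1) : ℂ) * (-2) ^ (k + 1) * f (k + 1) := by
    rw [binomialTransform, Finset.sum_range_succ', Finset.sum_range_succ _ N]
    simp [add_comm]
  rw [h, binomialTransform, Finset.sum_range_succ', binomialTransform, Finset.mul_sum,
    add_comm, add_sub_assoc, ← Finset.sum_sub_distrib]
  congr 1
  · simp
  · refine Finset.sum_congr rfl fun k _ => ?_
    rw [Nat.choose_succ_succ]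
    push_cast
    ring

lemma binomialTransform_one (N : ℕ) : binomialTransform N (fun _ => 1) = (-1) ^ N := by
  induction N with
  | zero => simp [binomialTransform]
  | succ n ih => rw [binomialTransform_succ, ih]; ring

lemma binomialTransform_inv_succ (N : ℕ) :
    2 * binomialTransform N (fun k => 1 / ((k : ℂ) + 1)) = (1 - (-1) ^ (N + 1)) / (N + 1) := by
  have hN : (N : ℂ) + 1 ≠ 0 := by exact_mod_cast N.succ_ne_zero
  rw [eq_div_iff hN, ← binomialTransform_one (N + 1), binomialTransform, binomialTransform,
    Finset.sum_range_succ' _ (N + 1), Finset.mul_sum, Finset.sum_mul]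
  simp only [Nat.choose_zero_right, Nat.cast_one, pow_zero, mul_one]
  rw [sub_add_cancel_right, ← Finset.sum_neg_distrib]
  refine Finset.sum_congr rfl fun k _ => ?_
  have hk : (k : ℂ) + 1 ≠ 0 := by exact_mod_cast k.succ_ne_zero
  have h : ((N : ℂ) + 1) * N.choose k = (N + 1).choose (k + 1) * (k + 1) := by
    exact_mod_cast Nat.add_one_mul_choose_eq N k
  field_simp
  linear_combination (2 * (-2 : ℂ) ^ k) * h

/-- `S_{-1}(N) - S_1(N)` as a complex number. -/
noncomputable def alternatingHarmonic (N : ℕ) : ℂ :=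
  ∑ n ∈ Finset.range N, ((-1) ^ (n + 1) - 1) / ((n : ℂ) + 1)

lemma nestedS_one_sub_nestedS_neg_one (N : ℕ) :
    ((4 * (nestedS [1] N - nestedS [-1] N) : ℝ) : ℂ) = -4 * alternatingHarmonic N := by
  induction N with
  | zero => simp [nestedS, alternatingHarmonic]
  | succ n ih =>
    simp only [nestedS, alternatingHarmonic, Finset.sum_range_succ] at ih ⊢
    rw [Finset.sum_Icc_succ_top (by omega), Finset.sum_Icc_succ_top (by omega), mul_add, ← ih]
    simp
    ring

lemma binomialTransform_inv (N : ℕ) :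
    binomialTransform N (fun k => 1 / (k : ℂ)) = alternatingHarmonic N := by
  induction N with
  | zero => simp [binomialTransform, alternatingHarmonic]
  | succ n ih =>
    rw [binomialTransform_succ, ih, alternatingHarmonic, alternatingHarmonic,
      Finset.sum_range_succ]
    have h := binomialTransform_inv_succ n
    push_cast
    rw [h]
    ring

lemma binomialTransform_harmonic (N : ℕ) :
    binomialTransform N (fun k => ∑ j ∈ Finset.range k, 1 / ((j : ℂ) + 1)) =
      -(-1) ^ N * alternatingHarmonic N := by
  induction N with
  | zero => simp [binomialTransform, alternatingHarmonic]
  | succ n ih =>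
    rw [binomialTransform_succ]
    simp only [Finset.sum_range_succ _ _]
    rw [binomialTransform_add, ih, mul_add, binomialTransform_inv_succ, alternatingHarmonic,
      alternatingHarmonic, Finset.sum_range_succ]
    have h : ((-1 : ℂ) ^ n) * (-1) ^ n = 1 := by rw [← mul_pow]; simp
    linear_combination (1 / ((n : ℂ) + 1)) * h

lemma two_pow_mul_ascPochhammer_neg_div (N k : ℕ) :
    2 ^ k * (ascPochhammer ℂ k).eval (-(N : ℂ)) / (k.factorial : ℂ) ^ 2 =
      (N.choose k : ℂ) * (-2) ^ k * (1 / k.factorial) := by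
  have hk : (k.factorial : ℂ) ≠ 0 := by exact_mod_cast k.factorial_ne_zero
  have h : (ascPochhammer ℂ k).eval (-(N : ℂ)) = (-1) ^ k * (k.factorial * N.choose k) := by
    rw [ascPochhammer_eval_neg_eq_descPochhammer, descPochhammer_eval_eq_descFactorial,
      Nat.descFactorial_eq_factorial_mul_choose]
    push_cast
    rfl
  rw [h, neg_pow (2 : ℂ)]
  field_simp

lemma eval_baxterQ1Poly (N : ℕ) (u : ℂ) :
    (baxterQ1Poly N).eval u = binomialTransform N fun k =>
      (ascPochhammer ℂ k).eval (Complex.I * u + 1 / 2) / k.factorial := by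
  simp only [baxterQ1Poly, binomialTransform, Polynomial.eval_finsetSum,
    two_pow_mul_ascPochhammer_neg_div, Polynomial.eval_mul, Polynomial.eval_C,
    Polynomial.eval_comp, Polynomial.eval_add, Polynomial.eval_X]
  refine Finset.sum_congr rfl fun k _ => ?_
  ring

lemma eval_derivative_baxterQ1Poly (N : ℕ) (u : ℂ) :
    (baxterQ1Poly N).derivative.eval u = Complex.I * binomialTransform N fun k =>
      (ascPochhammer ℂ k).derivative.eval (Complex.I * u + 1 / 2) / k.factorial := by
  simp only [baxterQ1Poly, binomialTransform, Polynomial.derivative_sum,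
    Polynomial.eval_finsetSum, two_pow_mul_ascPochhammer_neg_div, Polynomial.derivative_C_mul,
    Polynomial.derivative_comp, Polynomial.derivative_add, Polynomial.derivative_C,
    Polynomial.derivative_X, Polynomial.eval_mul, Polynomial.eval_C, Polynomial.eval_comp,
    Polynomial.eval_add, Polynomial.eval_X, Finset.mul_sum]
  refine Finset.sum_congr rfl fun k _ => ?_
  simp
  ring

lemma derivative_ascPochhammer_succ_eval (k : ℕ) (x : ℂ) :
    (ascPochhammer ℂ (k + 1)).derivative.eval x =
      (ascPochhammer ℂ k).derivative.eval x * (x + k) + (ascPochhammer ℂ k).eval x := by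
  rw [ascPochhammer_succ_right]
  simp [Polynomial.derivative_mul]

lemma derivative_ascPochhammer_eval_zero (k : ℕ) :
    (ascPochhammer ℂ k).derivative.eval 0 / k.factorial = 1 / (k : ℂ) := by
  induction k with
  | zero => simp
  | succ n ih =>
    have hf : (n.factorial : ℂ) ≠ 0 := by exact_mod_cast n.factorial_ne_zero
    have hn : (n : ℂ) + 1 ≠ 0 := by exact_mod_cast n.succ_ne_zero
    rw [derivative_ascPochhammer_succ_eval, Nat.factorial_succ]
    rcases n.eq_zero_or_pos with rfl | h
    · simp
    · have h0 : (n : ℂ) ≠ 0 := by exact_mod_cast h.ne'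
      rw [ascPochhammer_ne_zero_eval_zero _ h.ne']
      push_cast
      field_simp at ih ⊢
      linear_combination ih

lemma derivative_ascPochhammer_eval_one (k : ℕ) :
    (ascPochhammer ℂ k).derivative.eval 1 / k.factorial =
      ∑ j ∈ Finset.range k, 1 / ((j : ℂ) + 1) := by
  induction k with
  | zero => simp
  | succ n ih =>
    have hf : (n.factorial : ℂ) ≠ 0 := by exact_mod_cast n.factorial_ne_zero
    have hn : (n : ℂ) + 1 ≠ 0 := by exact_mod_cast n.succ_ne_zero
    rw [derivative_ascPochhammer_succ_eval, Nat.factorial_succ, Finset.sum_range_succ, ← ih,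
      ascPochhammer_eval_one]
    push_cast
    field_simp
    ring

lemma I_mul_half_I : Complex.I * (Complex.I / 2) + 1 / 2 = 0 := by
  linear_combination (1 / 2 : ℂ) * Complex.I_mul_I

lemma I_mul_neg_half_I : Complex.I * (-(Complex.I / 2)) + 1 / 2 = 1 := by
  linear_combination (-1 / 2 : ℂ) * Complex.I_mul_I

lemma eval_baxterQ1Poly_half_I (N : ℕ) : (baxterQ1Poly N).eval (Complex.I / 2) = 1 := by
  rw [eval_baxterQ1Poly, I_mul_half_I, binomialTransform, Finset.sum_range_succ',
    Finset.sum_eq_zero]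
  · simp
  · intro k _
    simp [ascPochhammer_ne_zero_eval_zero _ k.succ_ne_zero]

lemma eval_baxterQ1Poly_neg_half_I (N : ℕ) :
    (baxterQ1Poly N).eval (-(Complex.I / 2)) = (-1) ^ N := by
  rw [eval_baxterQ1Poly, I_mul_neg_half_I, ← binomialTransform_one]
  congr 1
  funext k
  rw [ascPochhammer_eval_one, div_self]
  exact_mod_cast k.factorial_ne_zero

/-- Bethe-root sums `Σ 1/(u² - c²)` in terms of logarithmic derivatives at `±c`. -/
lemma sum_roots_inv_sq_sub_sq (p : Polynomial ℂ) {c : ℂ} (hc : c ≠ 0) (h₁ : p.eval c ≠ 0)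
    (h₂ : p.eval (-c) ≠ 0) :
    (p.roots.map fun u => 1 / (u ^ 2 - c ^ 2)).sum =
      (p.derivative.eval (-c) / p.eval (-c) - p.derivative.eval c / p.eval c) / (2 * c) := by
  have hs := IsAlgClosed.splits p
  rw [hs.eval_derivative_div_eval_of_ne_zero h₁, hs.eval_derivative_div_eval_of_ne_zero h₂,
    ← Multiset.sum_map_sub, div_eq_mul_inv, ← Multiset.sum_map_mul_right]
  refine congrArg Multiset.sum (Multiset.map_congr rfl fun u hu => ?_)
  have hu' : p.eval u = 0 := (Polynomial.mem_roots'.mp hu).2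
  have e₁ : c - u ≠ 0 := fun h => h₁ (by rwa [sub_eq_zero.mp h])
  have e₂ : -c - u ≠ 0 := fun h => h₂ (by rwa [sub_eq_zero.mp h])
  have e₃ : u ^ 2 - c ^ 2 ≠ 0 := by
    have := mul_ne_zero e₁ e₂
    intro h
    apply this
    linear_combination h
  field_simp
  ring

/-- Two-loop twist-1 anomalous dimension: `±i/2` are not roots of the Baxter polynomial
and `Σ_k 2/(u_k² + 1/4) = 4·(S₁(N) − S_{−1}(N))` over its roots (with multiplicity). -/
theorem twist1_two_loop_anomalous_dimension (N : ℕ) :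
    ¬ (baxterQ1Poly N).IsRoot (Complex.I / 2) ∧
    ¬ (baxterQ1Poly N).IsRoot (-(Complex.I / 2)) ∧
    ((baxterQ1Poly N).roots.map (fun u => 2 / (u ^ 2 + 1 / 4))).sum
      = ((4 * (nestedS [1] N - nestedS [-1] N) : ℝ) : ℂ) := by
  have h₁ : (baxterQ1Poly N).eval (Complex.I / 2) ≠ 0 := by
    simp [eval_baxterQ1Poly_half_I]
  have h₂ : (baxterQ1Poly N).eval (-(Complex.I / 2)) ≠ 0 := by
    simp [eval_baxterQ1Poly_neg_half_I]
  refine ⟨h₁, h₂, ?_⟩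
  have hc : Complex.I / 2 ≠ 0 := by simp
  have hfun : (fun u : ℂ => 2 / (u ^ 2 + 1 / 4)) =
      fun u => 2 * (1 / (u ^ 2 - (Complex.I / 2) ^ 2)) := by
    funext u
    rw [div_pow, Complex.I_sq]
    ring
  rw [hfun, Multiset.sum_map_mul_left, sum_roots_inv_sq_sub_sq _ hc h₁ h₂,
    eval_derivative_baxterQ1Poly, eval_derivative_baxterQ1Poly, eval_baxterQ1Poly_half_I,
    eval_baxterQ1Poly_neg_half_I, I_mul_half_I, I_mul_neg_half_I,
    nestedS_one_sub_nestedS_neg_one]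
  simp only [derivative_ascPochhammer_eval_zero, derivative_ascPochhammer_eval_one]
  rw [binomialTransform_inv, binomialTransform_harmonic]
  have hI := Complex.I_ne_zero
  have hs : ((-1 : ℂ)) ^ N ≠ 0 := by simp
  field_simp
  ring
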